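/- arXiv:1508.06937 — 2 statements merged into one kernel-verified Lean document; each statement's English description precedes it below -/
import Mathlib

section
/- Let a8,a9 ∈ F_q^× and b2,b3,b4 ∈ F_q. Let W = {x(t) : t1 = t5 = 0}, a subgroup of H of order q^7, and define μ : W → ℂ by μ(x(t)) = φ(a8·t8 + a9·t9). Set χ(x(t)) = φ(b2·t2 + b3·t3 + b4·t4)·μ^H(x(t)). Then: if t3 = 0, χ(x(t)) = q^2·φ(b2·t2 + b4·t4 + a8·t8 + a9·t9) when t1 = t5 = 0, a8·t2 + a9·t4 = 0 and a8·t6 + a9·t7 = 0, and χ(x(t)) = 0 otherwise; if t3 ≠ 0, χ(x(t)) = q·φ(b2·t2 + b3·t3 + b4·t4 + a8·t8 + a9·t9 + t5·(a8·t2 + a9·t4 − (a8·t6 + a9·t7)/t3)) when t1 = 0 and a8·t2 + a9·t4 = 0, and χ(x(t)) = 0 otherwise. -/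
open Finset
open scoped Classical

noncomputable section

/-- The additive character `φ(x) = exp(2πi·Tr(x)/p)` of `F_q`, where `Tr` is the trace to `F_p`. -/
def phi (p : ℕ) (F : Type) [Field F] [Fintype F] [Algebra (ZMod p) F] (x : F) : ℂ :=
  Complex.exp (2 * Real.pi * Complex.I * ((Algebra.trace (ZMod p) F x).val : ℂ) / (p : ℂ))

namespace UM10

variable (F : Type) [Field F] [Fintype F]

/- `V = F_q^6` has coordinates `(t3,t5,t6,t7,t8,t9)`, indexed `0,…,5`. -/

/-- `σ1(s) : t5 ↦ t5 − s·t3, t8 ↦ t8 − s·t6, t9 ↦ t9 − s·t7`. -/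
def sig1 (s : F) (v : Fin 6 → F) : Fin 6 → F :=
  ![v 0, v 1 - s * v 0, v 2, v 3, v 4 - s * v 2, v 5 - s * v 3]

/-- `σ2(s) : t6 ↦ t6 − s·t3, t8 ↦ t8 − s·t5`. -/
def sig2 (s : F) (v : Fin 6 → F) : Fin 6 → F :=
  ![v 0, v 1, v 2 - s * v 0, v 3, v 4 - s * v 1, v 5]

/-- `σ4(s) : t7 ↦ t7 − s·t3, t9 ↦ t9 − s·t5`. -/
def sig4 (s : F) (v : Fin 6 → F) : Fin 6 → F :=
  ![v 0, v 1, v 2, v 3 - s * v 0, v 4, v 5 - s * v 1]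

/-- The composite action `σ1(s1)σ2(s2)σ4(s4)` of `F_q^3` on `V`. -/
def sigma (s : Fin 3 → F) (v : Fin 6 → F) : Fin 6 → F :=
  sig1 F (s 0) (sig2 F (s 1) (sig4 F (s 2) v))

/-- Multiplication in the semidirect product `H = F_q^3 ⋉ V`:
conjugating `(0,v)` by `(s,0)` yields `(0, σ1(s1)σ2(s2)σ4(s4)(v))`. -/
def Hmul (x y : (Fin 3 → F) × (Fin 6 → F)) : (Fin 3 → F) × (Fin 6 → F) :=
  (x.1 + y.1, sigma F y.1 x.2 + y.2)

/-- Inversion in `H`. -/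
def Hinv (x : (Fin 3 → F) × (Fin 6 → F)) : (Fin 3 → F) × (Fin 6 → F) :=
  (-x.1, -(sigma F (-x.1) x.2))

/-- Conjugation `x⁻¹ h x` in `H`. -/
def Hconj (x h : (Fin 3 → F) × (Fin 6 → F)) : (Fin 3 → F) × (Fin 6 → F) :=
  Hmul F (Hmul F (Hinv F x) h) x

/-- The element `x(t) = (0,(t3,0,…,0))·((t1,t2,t4),0)·(0,(0,t5,t6,t7,t8,t9))` of `H`,
for `t = (t1,…,t9)` (indexed `0,…,8`). -/
def xelt (t : Fin 9 → F) : (Fin 3 → F) × (Fin 6 → F) :=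
  Hmul F (Hmul F ((0 : Fin 3 → F), ![t 2, 0, 0, 0, 0, 0]) (![t 0, t 1, t 3], (0 : Fin 6 → F)))
    ((0 : Fin 3 → F), ![0, t 4, t 5, t 6, t 7, t 8])

/-- The extension by zero to `H` of a function on a subset `K` of `H`. -/
def dotExt (K : Set ((Fin 3 → F) × (Fin 6 → F))) (lam : (Fin 3 → F) × (Fin 6 → F) → ℂ)
    (h : (Fin 3 → F) × (Fin 6 → F)) : ℂ :=
  if h ∈ K then lam h else 0

/-- The induced class function `λ^H(h) = (1/|K|) ∑_{x∈H} λ̇(x⁻¹ h x)`, for `λ` defined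
on a subgroup `K` of order `cardK`. -/
def ind (cardK : ℕ) (K : Set ((Fin 3 → F) × (Fin 6 → F)))
    (lam : (Fin 3 → F) × (Fin 6 → F) → ℂ) (h : (Fin 3 → F) × (Fin 6 → F)) : ℂ :=
  (1 / (cardK : ℂ)) * ∑ x : (Fin 3 → F) × (Fin 6 → F), dotExt F K lam (Hconj F x h)

end UM10

/-- `phi` as an additive character. -/
def phiChar (p : ℕ) [Fact p.Prime] (F : Type) [Field F] [Fintype F] [Algebra (ZMod p) F] :
    AddChar F ℂ :=
  (ZMod.stdAddChar (N := p)).compAddMonoidHom (Algebra.trace (ZMod p) F).toAddMonoidHom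

theorem phiChar_apply (p : ℕ) [Fact p.Prime] (F : Type) [Field F] [Fintype F]
    [Algebra (ZMod p) F] (x : F) : phiChar p F x = phi p F x := by
  simp [phiChar, phi, ZMod.stdAddChar_apply, ZMod.toCircle_apply]

theorem phi_add (p : ℕ) [Fact p.Prime] (F : Type) [Field F] [Fintype F]
    [Algebra (ZMod p) F] (x y : F) : phi p F (x + y) = phi p F x * phi p F y := by
  simp only [← phiChar_apply, AddChar.map_add_eq_mul]

theorem phiChar_isPrimitive (p : ℕ) [Fact p.Prime] (F : Type) [Field F] [Fintype F]
    [Algebra (ZMod p) F] : (phiChar p F).IsPrimitive := by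
  apply AddChar.IsPrimitive.of_ne_one
  intro h
  obtain ⟨x, hx⟩ := Algebra.trace_surjective (ZMod p) F 1
  have h1 : ZMod.stdAddChar (N := p) 1 = 1 := by
    simpa [phiChar, hx] using DFunLike.congr_fun h x
  have h2 : ZMod.stdAddChar (N := p) 1 = ZMod.stdAddChar (N := p) 0 := by simpa using h1
  exact one_ne_zero (ZMod.injective_stdAddChar h2)

/-- Orthogonality: `∑ₓ φ(cx)` is `q` if `c = 0` and `0` otherwise. -/
theorem sum_phi_mul (p : ℕ) [Fact p.Prime] (F : Type) [Field F] [Fintype F]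
    [Algebra (ZMod p) F] (c : F) :
    ∑ x : F, phi p F (x * c) = if c = 0 then (Fintype.card F : ℂ) else 0 := by
  simpa [phiChar_apply] using AddChar.sum_mulShift c (phiChar_isPrimitive p F)

/-- Summing over all tuples a function of a single coordinate. -/
theorem sum_pi_single_coord {F : Type} [Fintype F] {n : ℕ} (i : Fin (n + 1)) (g : F → ℂ) :
    ∑ v : Fin (n + 1) → F, g (v i) = (Fintype.card F : ℂ) ^ n * ∑ a : F, g a := by
  rw [← (Fin.insertNthEquiv (fun _ => F) i).sum_comp, Fintype.sum_prod_type, Finset.mul_sum]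
  simp

namespace UM10

section Coordinates

variable (F : Type) [Field F] (s : Fin 3 → F) (v : Fin 6 → F)

theorem sigma_apply_zero : sigma F s v 0 = v 0 := rfl

theorem sigma_apply_one : sigma F s v 1 = v 1 - s 0 * v 0 := rfl

theorem sigma_apply_two : sigma F s v 2 = v 2 - s 1 * v 0 := rfl

theorem sigma_apply_three : sigma F s v 3 = v 3 - s 2 * v 0 := rfl

theorem sigma_apply_four :
    sigma F s v 4 = v 4 - s 1 * v 1 - s 0 * (v 2 - s 1 * v 0) := rfl

theorem sigma_apply_five :
    sigma F s v 5 = v 5 - s 2 * v 1 - s 0 * (v 3 - s 2 * v 0) := rfl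

theorem xelt_fst (t : Fin 9 → F) : (xelt F t).1 = ![t 0, t 1, t 3] := by
  simp [xelt, Hmul]

theorem xelt_snd (t : Fin 9 → F) :
    (xelt F t).2 = ![t 2, t 4 - t 0 * t 2, t 5 - t 1 * t 2, t 6 - t 3 * t 2,
      t 7 + t 0 * t 1 * t 2, t 8 + t 0 * t 3 * t 2] := by
  ext k
  fin_cases k <;> simp [xelt, Hmul, sigma, sig1, sig2, sig4] <;> ring

theorem Hconj_fst (x h : (Fin 3 → F) × (Fin 6 → F)) : (Hconj F x h).1 = h.1 := by
  simp [Hconj, Hmul, Hinv]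

theorem Hconj_snd (x h : (Fin 3 → F) × (Fin 6 → F)) :
    (Hconj F x h).2 = sigma F x.1 h.2 + x.2 - sigma F h.1 x.2 := by
  ext k
  simp only [Hconj, Hmul, Hinv]
  fin_cases k <;>
    simp only [Fin.zero_eta, Fin.mk_one, Fin.reduceFinMk, Pi.add_apply, Pi.sub_apply, Pi.neg_apply,
      sigma_apply_zero, sigma_apply_one, sigma_apply_two, sigma_apply_three, sigma_apply_four,
      sigma_apply_five] <;> ring

/-- Conjugates of `x(t)` lie in `W` iff `t₁ = 0` and `t₅ = r₁ t₃`. -/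
theorem mem_Hconj_xelt_iff (t : Fin 9 → F) (r : Fin 3 → F) (u : Fin 6 → F) :
    (Hconj F (r, u) (xelt F t)) ∈
        {h : (Fin 3 → F) × (Fin 6 → F) | h.1 0 = 0 ∧ h.2 1 = 0} ↔
      t 0 = 0 ∧ r 0 * t 2 = t 4 := by
  simp only [Set.mem_ofPred_eq, Hconj_fst, Hconj_snd, xelt_fst, xelt_snd, Pi.add_apply,
    Pi.sub_apply, sigma_apply_one, Matrix.cons_val]
  refine and_congr_right fun h => ?_
  rw [h]
  constructor <;> intro h' <;> linear_combination -h'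

/-- The exponent of `μ` at a conjugate of `x(t)` lying in `W`. -/
theorem Hconj_xelt_exponent (a8 a9 : F) (t : Fin 9 → F) (r : Fin 3 → F) (u : Fin 6 → F)
    (h0 : t 0 = 0) (h4 : r 0 * t 2 = t 4) :
    a8 * (Hconj F (r, u) (xelt F t)).2 4 + a9 * (Hconj F (r, u) (xelt F t)).2 5 =
      a8 * t 7 + a9 * t 8 + t 4 * (a8 * t 1 + a9 * t 3) + r 0 * -(a8 * t 5 + a9 * t 6) +
        u 1 * (a8 * t 1 + a9 * t 3) := by
  simp only [Hconj_snd, xelt_fst, xelt_snd, Pi.add_apply, Pi.sub_apply, sigma_apply_four,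
    sigma_apply_five, Matrix.cons_val, h0, ← h4]
  ring

end Coordinates

variable (F : Type) [Field F] [Fintype F]

/-- The character `μ^H` at `x(t)` as a sum over the first coordinate of the conjugator. -/
theorem ind_xelt (p : ℕ) [Fact p.Prime] [Algebra (ZMod p) F] (a8 a9 : F) (t : Fin 9 → F) :
    ind F ((Fintype.card F) ^ 7) {h | h.1 0 = 0 ∧ h.2 1 = 0}
        (fun h => phi p F (a8 * h.2 4 + a9 * h.2 5)) (xelt F t) =
      if t 0 = 0 ∧ a8 * t 1 + a9 * t 3 = 0 then
        (Fintype.card F : ℂ) * phi p F (a8 * t 7 + a9 * t 8) *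
          ∑ r : F, if r * t 2 = t 4 then phi p F (r * -(a8 * t 5 + a9 * t 6)) else 0
      else 0 := by
  have hq : (Fintype.card F : ℂ) ≠ 0 := by exact_mod_cast Fintype.card_ne_zero
  by_cases h0 : t 0 = 0
  · have key : ∀ (r : Fin 3 → F) (u : Fin 6 → F),
        dotExt F {h | h.1 0 = 0 ∧ h.2 1 = 0} (fun h => phi p F (a8 * h.2 4 + a9 * h.2 5))
          (Hconj F (r, u) (xelt F t)) =
        (phi p F (a8 * t 7 + a9 * t 8 + t 4 * (a8 * t 1 + a9 * t 3)) *
          if r 0 * t 2 = t 4 then phi p F (r 0 * -(a8 * t 5 + a9 * t 6)) else 0) *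
          phi p F (u 1 * (a8 * t 1 + a9 * t 3)) := by
      intro r u
      by_cases h4 : r 0 * t 2 = t 4
      · rw [dotExt, if_pos ((mem_Hconj_xelt_iff F t r u).2 ⟨h0, h4⟩), if_pos h4,
          Hconj_xelt_exponent F a8 a9 t r u h0 h4, phi_add,
          phi_add p F (a8 * t 7 + a9 * t 8 + t 4 * (a8 * t 1 + a9 * t 3))]
      · rw [dotExt, if_neg fun h => h4 ((mem_Hconj_xelt_iff F t r u).1 h).2, if_neg h4, mul_zero,
          zero_mul]
    simp only [ind, Fintype.sum_prod_type, key, ← Finset.mul_sum, ← Finset.sum_mul]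
    rw [sum_pi_single_coord (n := 5) 1 (fun a => phi p F (a * (a8 * t 1 + a9 * t 3))),
      sum_pi_single_coord (n := 2) 0
        (fun a => if a * t 2 = t 4 then phi p F (a * -(a8 * t 5 + a9 * t 6)) else 0),
      sum_phi_mul]
    by_cases hc : a8 * t 1 + a9 * t 3 = 0
    · simp only [h0, hc, and_self, if_true, mul_zero, add_zero]
      generalize Finset.sum (M := ℂ) (Finset.univ : Finset F) _ = S
      push_cast
      field_simp
    · simp [hc]
  · have key : ∀ x : (Fin 3 → F) × (Fin 6 → F),
        dotExt F {h | h.1 0 = 0 ∧ h.2 1 = 0} (fun h => phi p F (a8 * h.2 4 + a9 * h.2 5))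
          (Hconj F x (xelt F t)) = 0 := by
      rintro ⟨r, u⟩
      rw [dotExt, if_neg fun h => h0 ((mem_Hconj_xelt_iff F t r u).1 h).1]
    simp [ind, key, h0]

end UM10


open UM10 in
/-- the values of `χ(x(t)) = φ(b2·t2 + b3·t3 + b4·t4)·μ^H(x(t))`, where `μ` is the
linear character `μ(x(t)) = φ(a8·t8 + a9·t9)` of the subgroup `W = {x(t) : t1 = t5 = 0}` of
order `q^7`. -/
theorem stmt4 (p : ℕ) [Fact p.Prime] (F : Type) [Field F] [Fintype F] [CharP F p]
    [Algebra (ZMod p) F] (a8 a9 : F) (h8 : a8 ≠ 0) (h9 : a9 ≠ 0) (b2 b3 b4 : F)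
    (t : Fin 9 → F) :
    phi p F (b2 * t 1 + b3 * t 2 + b4 * t 3) *
      ind F ((Fintype.card F) ^ 7) {h | h.1 0 = 0 ∧ h.2 1 = 0}
        (fun h => phi p F (a8 * h.2 4 + a9 * h.2 5)) (xelt F t) =
    if t 2 = 0 then
      (if t 0 = 0 ∧ t 4 = 0 ∧ a8 * t 1 + a9 * t 3 = 0 ∧ a8 * t 5 + a9 * t 6 = 0 then
        (Fintype.card F : ℂ) ^ 2 * phi p F (b2 * t 1 + b4 * t 3 + a8 * t 7 + a9 * t 8)
      else 0)
    else
      (if t 0 = 0 ∧ a8 * t 1 + a9 * t 3 = 0 then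
        (Fintype.card F : ℂ) *
          phi p F (b2 * t 1 + b3 * t 2 + b4 * t 3 + a8 * t 7 + a9 * t 8 +
            t 4 * (a8 * t 1 + a9 * t 3 - (a8 * t 5 + a9 * t 6) / t 2))
      else 0) := by
  rw [ind_xelt]
  by_cases h : t 0 = 0 ∧ a8 * t 1 + a9 * t 3 = 0
  · obtain ⟨h0, hc⟩ := h
    by_cases h2 : t 2 = 0
    · by_cases h4 : t 4 = 0
      · simp only [h0, hc, h2, h4, mul_zero, if_true, true_and, add_zero, sum_phi_mul, neg_eq_zero]
        split_ifs
        · rw [add_assoc (b2 * t 1 + b4 * t 3), phi_add p F (b2 * t 1 + b4 * t 3)]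
          ring
        · simp
      · simp [h2, h4, Ne.symm h4]
    · have hr : ∀ r : F, r * t 2 = t 4 ↔ r = t 4 / t 2 := fun r => (eq_div_iff h2).symm
      simp only [h0, hc, h2, hr, and_self, if_true, if_false, Finset.sum_ite_eq',
        Finset.mem_univ]
      rw [show b2 * t 1 + b3 * t 2 + b4 * t 3 + a8 * t 7 + a9 * t 8 +
          t 4 * (0 - (a8 * t 5 + a9 * t 6) / t 2) = (b2 * t 1 + b3 * t 2 + b4 * t 3) +
          ((a8 * t 7 + a9 * t 8) + t 4 / t 2 * -(a8 * t 5 + a9 * t 6)) by ring,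
        phi_add p F (b2 * t 1 + b3 * t 2 + b4 * t 3), phi_add p F (a8 * t 7 + a9 * t 8)]
      ring
  · have h' : ¬ (t 0 = 0 ∧ t 4 = 0 ∧ a8 * t 1 + a9 * t 3 = 0 ∧ a8 * t 5 + a9 * t 6 = 0) :=
      fun k => h ⟨k.1, k.2.2.1⟩
    simp only [if_neg h, if_neg h', ite_self, mul_zero]
end
end

section
/- Suppose p = 2. Let a11 ∈ F_q^× and b3,b5,b6,b7 ∈ F_q, with λ(t3,t5,t6,t7,t8,t9,t10,t11) = φ(b5·t5 + b6·t6 + b7·t7 + a11·t11) on K = {0}×V and χ(x(t)) = φ(b3·t3)·λ^H(x(t)). Then: (a) at t with t1 = t2 = t3 = t4 = t8 = t9 = 0, t5,t6,t7,t10 ∈ F_q^× and t11 ∈ F_q, χ(x(t)) = q·φ(b5·t5 + b6·t6 + b7·t7 + a11·t11)·∑_{s∈F_q} φ(a11·(t5·t6·t7·s^2 + t5·t10·s)); (b) at t with t5,t6,t7 ∈ F_q^× and all other coordinates equal to 0, χ(x(t)) = 0. -/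
open Finset
open scoped Classical

noncomputable section

namespace UM12

variable (F : Type) [Field F] [Fintype F]

/- `V = F_q^8` has coordinates `(t3,t5,t6,t7,t8,t9,t10,t11)`, indexed `0,…,7`. -/

/-- `σ1(s) : t5 ↦ t5 − s·t3, t8 ↦ t8 − s·t6, t9 ↦ t9 − s·t7, t11 ↦ t11 − s·t10`. -/
def sig1 (s : F) (v : Fin 8 → F) : Fin 8 → F :=
  ![v 0, v 1 - s * v 0, v 2, v 3, v 4 - s * v 2, v 5 - s * v 3, v 6, v 7 - s * v 6]

/-- `σ2(s) : t6 ↦ t6 − s·t3, t8 ↦ t8 − s·t5, t10 ↦ t10 − s·t7, t11 ↦ t11 − s·t9`. -/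
def sig2 (s : F) (v : Fin 8 → F) : Fin 8 → F :=
  ![v 0, v 1, v 2 - s * v 0, v 3, v 4 - s * v 1, v 5, v 6 - s * v 3, v 7 - s * v 5]

/-- `σ4(s) : t7 ↦ t7 − s·t3, t9 ↦ t9 − s·t5, t10 ↦ t10 − s·t6, t11 ↦ t11 − s·t8`. -/
def sig4 (s : F) (v : Fin 8 → F) : Fin 8 → F :=
  ![v 0, v 1, v 2, v 3 - s * v 0, v 4, v 5 - s * v 1, v 6 - s * v 2, v 7 - s * v 4]

/-- The composite action `σ1(s1)σ2(s2)σ4(s4)` of `F_q^3` on `V`. -/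
def sigma (s : Fin 3 → F) (v : Fin 8 → F) : Fin 8 → F :=
  sig1 F (s 0) (sig2 F (s 1) (sig4 F (s 2) v))

/-- Multiplication in the semidirect product `H = F_q^3 ⋉ V`:
conjugating `(0,v)` by `(s,0)` yields `(0, σ1(s1)σ2(s2)σ4(s4)(v))`. -/
def Hmul (x y : (Fin 3 → F) × (Fin 8 → F)) : (Fin 3 → F) × (Fin 8 → F) :=
  (x.1 + y.1, sigma F y.1 x.2 + y.2)

/-- Inversion in `H`. -/
def Hinv (x : (Fin 3 → F) × (Fin 8 → F)) : (Fin 3 → F) × (Fin 8 → F) :=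
  (-x.1, -(sigma F (-x.1) x.2))

/-- Conjugation `x⁻¹ h x` in `H`. -/
def Hconj (x h : (Fin 3 → F) × (Fin 8 → F)) : (Fin 3 → F) × (Fin 8 → F) :=
  Hmul F (Hmul F (Hinv F x) h) x

/-- The element `x(t) = (0,(t3,0,…,0))·((t1,t2,t4),0)·(0,(0,t5,t6,t7,t8,t9,t10,t11))` of `H`,
for `t = (t1,…,t11)` (indexed `0,…,10`). -/
def xelt (t : Fin 11 → F) : (Fin 3 → F) × (Fin 8 → F) :=
  Hmul F
    (Hmul F ((0 : Fin 3 → F), ![t 2, 0, 0, 0, 0, 0, 0, 0]) (![t 0, t 1, t 3], (0 : Fin 8 → F)))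
    ((0 : Fin 3 → F), ![0, t 4, t 5, t 6, t 7, t 8, t 9, t 10])

/-- The extension by zero `λ̇` to `H` of a function `λ` on `K = {0} × V`. -/
def lamDot (lam : (Fin 8 → F) → ℂ) (h : (Fin 3 → F) × (Fin 8 → F)) : ℂ :=
  if h.1 = 0 then lam h.2 else 0

/-- The induced class function `λ^H(h) = (1/q^8) ∑_{x∈H} λ̇(x⁻¹ h x)`. -/
def ind (lam : (Fin 8 → F) → ℂ) (h : (Fin 3 → F) × (Fin 8 → F)) : ℂ :=
  (1 / (Fintype.card F : ℂ) ^ 8) * ∑ x : (Fin 3 → F) × (Fin 8 → F), lamDot F lam (Hconj F x h)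

end UM12
namespace UM12

/-- `phi` as an additive character: the standard character of `ZMod p` composed with the trace. -/
def phiChar (p : ℕ) [NeZero p] (F : Type) [Field F] [Algebra (ZMod p) F] : AddChar F ℂ :=
  ZMod.stdAddChar.compAddMonoidHom (Algebra.trace (ZMod p) F).toAddMonoidHom

lemma phi_eq_phiChar (p : ℕ) [NeZero p] (F : Type) [Field F] [Fintype F] [Algebra (ZMod p) F]
    (x : F) : phi p F x = phiChar p F x := by
  simp [phi, phiChar, ZMod.stdAddChar_apply, ZMod.toCircle_apply]

lemma phiChar_isPrimitive (p : ℕ) [Fact p.Prime] (F : Type) [Field F] [Fintype F]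
    [Algebra (ZMod p) F] : (phiChar p F).IsPrimitive := by
  refine AddChar.IsPrimitive.of_ne_one (AddChar.ne_one_iff.2 ?_)
  obtain ⟨x, hx⟩ := Algebra.trace_surjective (ZMod p) F 1
  refine ⟨x, fun h => one_ne_zero (α := ZMod p) (ZMod.injective_stdAddChar ?_)⟩
  simpa [phiChar, hx] using h

lemma sum_fin_three_fun (F : Type) [Fintype F] (f : (Fin 3 → F) → ℂ) :
    ∑ s, f s = ∑ a, ∑ b, ∑ c, f ![a, b, c] := by
  simp_rw [← Fintype.sum_prod_type']
  refine Fintype.sum_equiv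
    { toFun := fun s => (s 0, s 1, s 2)
      invFun := fun y => ![y.1, y.2.1, y.2.2]
      left_inv := fun s => by ext i; fin_cases i <;> rfl
      right_inv := fun y => rfl } _ _ fun s => ?_
  congr 1
  ext i
  fin_cases i <;> rfl

section Action

variable (F : Type) [Field F]

lemma sigma_add (s : Fin 3 → F) (v w : Fin 8 → F) :
    sigma F s (v + w) = sigma F s v + sigma F s w := by
  ext i
  fin_cases i <;> simp [sigma, sig1, sig2, sig4] <;> ring

lemma sigma_neg (s : Fin 3 → F) (v : Fin 8 → F) : sigma F s (-v) = -sigma F s v := by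
  ext i
  fin_cases i <;> simp [sigma, sig1, sig2, sig4] <;> ring

lemma sigma_sigma_neg (s : Fin 3 → F) (v : Fin 8 → F) : sigma F s (sigma F (-s) v) = v := by
  ext i
  fin_cases i <;> simp [sigma, sig1, sig2, sig4] <;> ring

lemma sigma_zero (v : Fin 8 → F) : sigma F 0 v = v := by
  ext i
  fin_cases i <;> simp [sigma, sig1, sig2, sig4]

lemma Hconj_zero_left (x : (Fin 3 → F) × (Fin 8 → F)) (v : Fin 8 → F) :
    Hconj F x (0, v) = (0, sigma F x.1 v) := by
  simp [Hconj, Hmul, Hinv, sigma_zero, sigma_add, sigma_neg, sigma_sigma_neg]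

lemma xelt_eq_of_mem_kernel (t5 t6 t7 t8 t9 t10 t11 : F) :
    xelt F ![0, 0, 0, 0, t5, t6, t7, t8, t9, t10, t11] =
      (0, ![0, t5, t6, t7, t8, t9, t10, t11]) := by
  ext i
  · fin_cases i <;> simp [xelt, Hmul]
  · fin_cases i <;> simp [xelt, Hmul, sigma, sig1, sig2, sig4]

/-- On the normal subgroup `{0} × V`, the induced function is a sum over the orbit parameters. -/
lemma ind_zero_left [Fintype F] (lam : (Fin 8 → F) → ℂ) (v : Fin 8 → F) :
    ind F lam (0, v) = ∑ a, ∑ b, ∑ c, lam (sigma F ![a, b, c] v) := by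
  have hq : (Fintype.card F : ℂ) ≠ 0 := Nat.cast_ne_zero.2 Fintype.card_ne_zero
  simp only [ind, Hconj_zero_left, lamDot, if_true, Fintype.sum_prod_type, sum_const, card_univ,
    Fintype.card_fun, Fintype.card_fin, nsmul_eq_mul, ← mul_sum]
  rw [sum_fin_three_fun]
  push_cast
  field_simp

end Action

/-- In characteristic two, the sum over the `σ4`-parameter forces `s2 * t5 = s1 * t6`, which leaves
a one-parameter quadratic sum. -/
lemma ind_linear_char (F : Type) [Field F] [Fintype F] [CharP F 2] [Algebra (ZMod 2) F]
    {a11 : F} (h11 : a11 ≠ 0) (b5 b6 b7 t6 t7 t10 t11 : F) {t5 : F} (h5 : t5 ≠ 0) :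
    ind F (fun v => phi 2 F (b5 * v 1 + b6 * v 2 + b7 * v 3 + a11 * v 7))
        (xelt F ![0, 0, 0, 0, t5, t6, t7, 0, 0, t10, t11]) =
      (Fintype.card F : ℂ) * phi 2 F (b5 * t5 + b6 * t6 + b7 * t7 + a11 * t11) *
        ∑ s : F, phi 2 F (a11 * (t5 * t6 * t7 * s ^ 2 + t5 * t10 * s)) := by
  have key : ∀ a b c : F,
      phi 2 F (b5 * sigma F ![a, b, c] ![0, t5, t6, t7, 0, 0, t10, t11] 1 +
        b6 * sigma F ![a, b, c] ![0, t5, t6, t7, 0, 0, t10, t11] 2 +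
        b7 * sigma F ![a, b, c] ![0, t5, t6, t7, 0, 0, t10, t11] 3 +
        a11 * sigma F ![a, b, c] ![0, t5, t6, t7, 0, 0, t10, t11] 7) =
      phi 2 F (b5 * t5 + b6 * t6 + b7 * t7 + a11 * t11) *
        (phi 2 F (a11 * (a * t10 + a * b * t7)) * phi 2 F (c * (a11 * (b * t5 + a * t6)))) := by
    intro a b c
    simp only [phi_eq_phiChar, ← AddChar.map_add_eq_mul]
    congr 1
    simp [sigma, sig1, sig2, sig4, CharTwo.sub_eq_add]
    ring
  have inner : ∀ a b : F, ∑ c : F, phi 2 F (c * (a11 * (b * t5 + a * t6))) =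
      if b = a * t6 / t5 then (Fintype.card F : ℂ) else 0 := by
    intro a b
    have hiff : a11 * (b * t5 + a * t6) = 0 ↔ b = a * t6 / t5 := by
      rw [mul_eq_zero, or_iff_right h11, CharTwo.add_eq_zero, eq_div_iff h5]
    simp only [phi_eq_phiChar, AddChar.sum_mulShift _ (phiChar_isPrimitive 2 F), hiff]
    split_ifs <;> simp
  rw [xelt_eq_of_mem_kernel, ind_zero_left]
  simp only [key, ← mul_sum, inner, mul_ite, mul_zero, sum_ite_eq', mem_univ, if_true]
  rw [← sum_mul, ← (mulLeft_bijective₀ t5 h5).sum_comp, mul_comm (∑ _, _), ← mul_assoc,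
    mul_comm (phi 2 F _)]
  congr 1
  refine sum_congr rfl fun s _ => congrArg (phi 2 F) ?_
  field_simp
  ring

lemma sum_phi_mul_sq_eq_zero (F : Type) [Field F] [Fintype F] [CharP F 2] [Algebra (ZMod 2) F]
    {c : F} (hc : c ≠ 0) : ∑ s : F, phi 2 F (s ^ 2 * c) = 0 := by
  have hb : Function.Bijective fun x : F => x ^ 2 := PerfectRing.bijective_frobenius
  rw [hb.sum_comp fun x => phi 2 F (x * c)]
  simp only [phi_eq_phiChar, AddChar.sum_mulShift _ (phiChar_isPrimitive 2 F), if_neg hc,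
    Nat.cast_zero]

lemma phi_zero (p : ℕ) [NeZero p] (F : Type) [Field F] [Fintype F] [Algebra (ZMod p) F] :
    phi p F 0 = 1 := by
  rw [phi_eq_phiChar, AddChar.map_zero_eq_one]

end UM12

open UM12 in
/-- for `p = 2`, values of `χ(x(t)) = φ(b3·t3)·λ^H(x(t))`, where
`λ(t3,t5,t6,t7,t8,t9,t10,t11) = φ(b5·t5 + b6·t6 + b7·t7 + a11·t11)` on `K = {0}×V`:
parts (a) and (b). -/
theorem stmt18 (F : Type) [Field F] [Fintype F] [CharP F 2]
    [Algebra (ZMod 2) F] (a11 : F) (h11 : a11 ≠ 0) (b3 b5 b6 b7 : F) :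
    (∀ t5 t6 t7 t10 t11 : F, t5 ≠ 0 → t6 ≠ 0 → t7 ≠ 0 → t10 ≠ 0 →
      phi 2 F (b3 * (0 : F)) *
        ind F (fun v => phi 2 F (b5 * v 1 + b6 * v 2 + b7 * v 3 + a11 * v 7))
          (xelt F ![0, 0, 0, 0, t5, t6, t7, 0, 0, t10, t11]) =
      (Fintype.card F : ℂ) * phi 2 F (b5 * t5 + b6 * t6 + b7 * t7 + a11 * t11) *
        ∑ s : F, phi 2 F (a11 * (t5 * t6 * t7 * s ^ 2 + t5 * t10 * s))) ∧
    (∀ t5 t6 t7 : F, t5 ≠ 0 → t6 ≠ 0 → t7 ≠ 0 →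
      phi 2 F (b3 * (0 : F)) *
        ind F (fun v => phi 2 F (b5 * v 1 + b6 * v 2 + b7 * v 3 + a11 * v 7))
          (xelt F ![0, 0, 0, 0, t5, t6, t7, 0, 0, 0, 0]) = 0) := by
  simp only [mul_zero, phi_zero, one_mul]
  refine ⟨fun t5 t6 t7 t10 t11 h5 _ _ _ => ind_linear_char F h11 b5 b6 b7 t6 t7 t10 t11 h5,
    fun t5 t6 t7 h5 h6 h7 => ?_⟩
  rw [ind_linear_char F h11 b5 b6 b7 t6 t7 0 0 h5]
  have hc : a11 * (t5 * t6 * t7) ≠ 0 := by simp [h11, h5, h6, h7]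
  have hsum := sum_phi_mul_sq_eq_zero F hc
  simp only [mul_zero, zero_mul, add_zero, ← mul_assoc, mul_comm _ (_ ^ 2)] at hsum ⊢
  rw [hsum, mul_zero]
end
end
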